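/- Improved expressiveness for Heaviside-type activations: assume w₁ ≥ 2 and that each activation function is of Heaviside type, i.e., there exist constants c_i ∈ ℝ (i = 1, …, L) with σ_i(s) = 0 for s < 0, σ_i(0) = c_i, and σ_i(s) = 1 for s > 0. Then for every y_d ∈ Y with y_d ≠ 0 one has inf_{α ∈ D} ‖Ψ(α) − y_d‖_Y² < ‖y_d‖_Y², and moreover Θ(Ψ) ≤ 1 − 1/n. -/

import Mathlib

noncomputable section

/-- The norm `‖y‖_Y = ((1/(2n)) · Σ_k ‖y_k‖₂²)^{1/2}` on `Y = (ℝ^{d_y})^n`. -/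
def normY {dy n : ℕ} (y : Fin n → Fin dy → ℝ) : ℝ :=
  Real.sqrt (1 / (2 * (n : ℝ)) * ∑ k, ∑ j, y k j ^ 2)

/-- Output of the `i`-th hidden layer of a fully connected feedforward network with widths
`w`, activation functions `σ` (layer `i` uses `σ i`, applied componentwise), weight matrices
`A i : ℝ^{w (i+1) × w i}` and biases `b i : ℝ^{w (i+1)}` (the data of layer `i + 1`). -/
def hiddenNN (w : ℕ → ℕ) (σ : ℕ → ℝ → ℝ)
    (A : (i : ℕ) → Fin (w (i + 1)) → Fin (w i) → ℝ)
    (b : (i : ℕ) → Fin (w (i + 1)) → ℝ) :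
    (i : ℕ) → (Fin (w 0) → ℝ) → Fin (w i) → ℝ
  | 0 => fun z => z
  | i + 1 => fun z j => σ (i + 1) ((∑ k, A i j k * hiddenNN w σ A b i z k) + b i j)

/-- The network `ψ(α, ·) : ℝ^{w 0} → ℝ^{w (L+1)}` with `L` (activated) hidden layers and an
affine output layer. -/
def netNN (w : ℕ → ℕ) (L : ℕ) (σ : ℕ → ℝ → ℝ)
    (A : (i : ℕ) → Fin (w (i + 1)) → Fin (w i) → ℝ)
    (b : (i : ℕ) → Fin (w (i + 1)) → ℝ)
    (z : Fin (w 0) → ℝ) : Fin (w (L + 1)) → ℝ :=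
  fun j => (∑ k, A L j k * hiddenNN w σ A b L z k) + b L j

/-- The optimal value of the squared loss over all network parameters. -/
def lossInfNN (w : ℕ → ℕ) (L n : ℕ) (σ : ℕ → ℝ → ℝ)
    (x : Fin n → Fin (w 0) → ℝ) (y : Fin n → Fin (w (L + 1)) → ℝ) : ℝ :=
  sInf {r : ℝ | ∃ (A : (i : ℕ) → Fin (w (i + 1)) → Fin (w i) → ℝ)
      (b : (i : ℕ) → Fin (w (i + 1)) → ℝ),
      r = normY ((fun k => netNN w L σ A b (x k)) - y) ^ 2}

/-- The worst-case error bound `Θ(Ψ)` of the network over unit label vectors. -/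
def ThetaNN (w : ℕ → ℕ) (L n : ℕ) (σ : ℕ → ℝ → ℝ)
    (x : Fin n → Fin (w 0) → ℝ) : ℝ :=
  sSup {t : ℝ | ∃ y : Fin n → Fin (w (L + 1)) → ℝ, normY y = 1 ∧ t = lossInfNN w L n σ x y}

/-- A linear functional separates a point of a finite injective family from all others, with a
uniform gap. -/
lemma exists_linear_separation {ι : Type*} [Finite ι] {d : ℕ} {x : ι → Fin d → ℝ}
    (hx : Function.Injective x) (l : ι) :
    ∃ (a : Fin d → ℝ) (δ : ℝ), 0 < δ ∧
      ∀ k, k ≠ l → δ < |(∑ m, a m * x k m) - ∑ m, a m * x l m| := by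
  obtain ⟨f, hf⟩ := Module.exists_dual_forall_apply_ne_zero (K := ℝ)
    (fun k : {k // k ≠ l} => x k - x l) (fun k => sub_ne_zero.2 (hx.ne k.2))
  have hsum (z : Fin d → ℝ) : ∑ m, f (Pi.single m 1) * z m = f z := by
    rw [LinearMap.pi_apply_eq_sum_univ f z]
    exact Finset.sum_congr rfl fun m _ => by
      rw [smul_eq_mul, mul_comm]
      congr 2
      ext j
      simp [Pi.single_apply, eq_comm]
  have hev : ∀ᶠ δ in nhdsWithin (0 : ℝ) (Set.Ioi 0),
      ∀ k : {k // k ≠ l}, δ < |f (x k - x l)| :=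
    Filter.eventually_all.2 fun k =>
      nhdsWithin_le_nhds (Iio_mem_nhds (abs_pos.2 (hf k)))
  obtain ⟨δ, hδ, hpos⟩ := (hev.and self_mem_nhdsWithin).exists
  refine ⟨fun m => f (Pi.single m 1), δ, hpos, fun k hk => ?_⟩
  simpa only [hsum, map_sub] using hδ ⟨k, hk⟩

/-- A network with Heaviside-type activations and at least two neurons in the first hidden layer
can take any prescribed value at one training input while vanishing at all others. -/
lemma exists_netNN_eq_single {L n : ℕ} (hL : 1 ≤ L) {w : ℕ → ℕ} (hw : ∀ i, 1 ≤ w i)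
    (hw1 : 2 ≤ w 1) {σ : ℕ → ℝ → ℝ}
    (hneg : ∀ i, 1 ≤ i → i ≤ L → ∀ s : ℝ, s < 0 → σ i s = 0)
    (hpos : ∀ i, 1 ≤ i → i ≤ L → ∀ s : ℝ, 0 < s → σ i s = 1)
    {x : Fin n → Fin (w 0) → ℝ} (hx : Function.Injective x)
    (l : Fin n) (v : Fin (w (L + 1)) → ℝ) :
    ∃ (A : (i : ℕ) → Fin (w (i + 1)) → Fin (w i) → ℝ) (b : (i : ℕ) → Fin (w (i + 1)) → ℝ),
      (fun k => netNN w L σ A b (x k)) = Pi.single l v := by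
  obtain ⟨M, rfl⟩ : ∃ M, L = M + 1 := ⟨L - 1, by omega⟩
  obtain ⟨a, δ, hδ, hsep⟩ := exists_linear_separation hx l
  set t : ℝ := ∑ m, a m * x l m with ht
  -- `u i` and `c i` are the weights and bias that read the indicator of `l` off hidden layer `i + 1`
  let u : (i : ℕ) → Fin (w (i + 1)) → ℝ := fun
    | 0 => Pi.single ⟨0, by simp; omega⟩ 1 + Pi.single ⟨1, by simp; omega⟩ 1
    | i + 1 => Pi.single ⟨0, hw _⟩ 1
  let c : ℕ → ℝ := fun
    | 0 => -1
    | _ + 1 => 0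
  let V : (i : ℕ) → Fin (w (i + 1)) → ℝ := Function.update (fun _ _ => 1) (M + 1) v
  let A : (i : ℕ) → Fin (w (i + 1)) → Fin (w i) → ℝ := fun
    | 0 => fun j m => if j.val = 0 then a m else -a m
    | i + 1 => fun j m => V (i + 1) j * u i m
  let b : (i : ℕ) → Fin (w (i + 1)) → ℝ := fun
    | 0 => fun j => if j.val = 0 then δ - t else δ + t
    | i + 1 => fun j => V (i + 1) j * c i - if i = M then 0 else 1 / 2
  have hread (k : Fin n) (i : ℕ) (hi : i ≤ M) :
      (∑ j, u i j * hiddenNN w σ A b (i + 1) (x k) j) + c i = if k = l then 1 else 0 := by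
    induction i with
    | zero =>
      have hn := hneg 1 le_rfl hL
      have hp := hpos 1 le_rfl hL
      simp only [u, c, Pi.add_apply, add_mul, Finset.sum_add_distrib, Pi.single_apply, ite_mul,
        one_mul, zero_mul, Finset.sum_ite_eq', Finset.mem_univ, if_true, hiddenNN, A, b,
        one_ne_zero, if_false, neg_mul, Finset.sum_neg_distrib, zero_add]
      by_cases hk : k = l
      · subst hk
        rw [if_pos rfl, hp _ (by linarith), hp _ (by linarith)]
        norm_num
      · rw [if_neg hk]
        rcases lt_abs.1 (hsep k hk) with h | h
        · rw [hp _ (by linarith), hn _ (by linarith)]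
          norm_num
        · rw [hn _ (by linarith), hp _ (by linarith)]
          norm_num
    | succ i ih =>
      have hV : V (i + 1) = fun _ => 1 := Function.update_of_ne (by omega) _ _
      have hiM : i ≠ M := by omega
      have hih := ih (by omega)
      simp only [u, c, Pi.single_apply, ite_mul, one_mul, zero_mul, Finset.sum_ite_eq',
        Finset.mem_univ, if_true, add_zero]
      rw [hiddenNN]
      simp only [A, b, hV, one_mul, if_neg hiM]
      rw [← add_sub_assoc, hih]
      split_ifs
      · exact hpos _ (by omega) (by omega) _ (by norm_num)
      · exact hneg _ (by omega) (by omega) _ (by norm_num)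
  refine ⟨A, b, ?_⟩
  ext k j
  have hV : V (M + 1) = v := Function.update_self _ _ _
  simp only [netNN, A, b, hV, if_true, sub_zero, mul_assoc]
  rw [← Finset.mul_sum, ← mul_add, hread k M le_rfl]
  by_cases hk : k = l
  · subst hk
    simp
  · simp [hk]

lemma normY_sq {dy n : ℕ} (y : Fin n → Fin dy → ℝ) :
    normY y ^ 2 = 1 / (2 * (n : ℝ)) * ∑ k, ∑ j, y k j ^ 2 :=
  Real.sq_sqrt (by positivity)

/-- Fitting a training label of maximal norm exactly removes at least the fraction `1 / n` of the
squared norm. -/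
lemma exists_normY_single_sub_sq_le {dy n : ℕ} (hn : 0 < n) (y : Fin n → Fin dy → ℝ) :
    ∃ l, normY (Pi.single l (y l) - y) ^ 2 ≤ (1 - 1 / (n : ℝ)) * normY y ^ 2 := by
  have : Nonempty (Fin n) := ⟨⟨0, hn⟩⟩
  obtain ⟨l, hl⟩ := Finite.exists_max fun k => ∑ j, y k j ^ 2
  refine ⟨l, ?_⟩
  have hn' : (0 : ℝ) < n := Nat.cast_pos.2 hn
  have hle : (∑ k, ∑ j, y k j ^ 2) ≤ n * ∑ j, y l j ^ 2 := by
    simpa using Finset.sum_le_card_nsmul Finset.univ _ _ fun k _ => hl k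
  have hres : (∑ k, ∑ j, (Pi.single l (y l) - y : Fin n → Fin dy → ℝ) k j ^ 2)
      = (∑ k, ∑ j, y k j ^ 2) - ∑ j, y l j ^ 2 := by
    rw [← Finset.add_sum_erase _ _ (Finset.mem_univ l),
      ← Finset.add_sum_erase _ (fun k => ∑ j, y k j ^ 2) (Finset.mem_univ l), add_sub_cancel_left]
    simp only [Pi.sub_apply, Pi.single_eq_same, sub_self, ne_eq, OfNat.ofNat_ne_zero,
      not_false_eq_true, zero_pow, Finset.sum_const_zero, zero_add]
    refine Finset.sum_congr rfl fun k hk => Finset.sum_congr rfl fun j _ => ?_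
    rw [Pi.single_eq_of_ne (Finset.ne_of_mem_erase hk)]
    simp
  rw [normY_sq, normY_sq, hres, mul_left_comm]
  refine mul_le_mul_of_nonneg_left ?_ (by positivity)
  rw [sub_mul, one_mul, one_div, inv_mul_eq_div]
  exact sub_le_sub_left ((div_le_iff₀' hn').2 hle) _

theorem heaviside_expressiveness
    (L n : ℕ) (hL : 1 ≤ L) (hn : 2 ≤ n)
    (w : ℕ → ℕ) (hw : ∀ i, 1 ≤ w i) (hw1 : 2 ≤ w 1)
    (σ : ℕ → ℝ → ℝ)
    (hσ : ∀ i, 1 ≤ i → i ≤ L → ∃ c : ℝ,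
      (∀ s : ℝ, s < 0 → σ i s = 0) ∧ σ i 0 = c ∧ (∀ s : ℝ, 0 < s → σ i s = 1))
    (x : Fin n → Fin (w 0) → ℝ) (hx : Function.Injective x) :
    (∀ y : Fin n → Fin (w (L + 1)) → ℝ, y ≠ 0 →
      lossInfNN w L n σ x y < normY y ^ 2) ∧
    ThetaNN w L n σ x ≤ 1 - 1 / (n : ℝ) := by
  have hn0 : (0 : ℝ) < n := by positivity
  have hbound (y : Fin n → Fin (w (L + 1)) → ℝ) :
      lossInfNN w L n σ x y ≤ (1 - 1 / (n : ℝ)) * normY y ^ 2 := by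
    obtain ⟨l, hl⟩ := exists_normY_single_sub_sq_le (by omega) y
    have hneg (i : ℕ) (h1 : 1 ≤ i) (h2 : i ≤ L) : ∀ s : ℝ, s < 0 → σ i s = 0 :=
      (hσ i h1 h2).choose_spec.1
    have hpos (i : ℕ) (h1 : 1 ≤ i) (h2 : i ≤ L) : ∀ s : ℝ, 0 < s → σ i s = 1 :=
      (hσ i h1 h2).choose_spec.2.2
    obtain ⟨A, b, hAb⟩ := exists_netNN_eq_single hL hw hw1 hneg hpos hx l (y l)
    refine le_trans ?_ hl
    rw [← hAb]
    refine csInf_le ⟨0, ?_⟩ ⟨A, b, rfl⟩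
    rintro _ ⟨A, b, rfl⟩
    positivity
  refine ⟨fun y hy => (hbound y).trans_lt ?_, ?_⟩
  · obtain ⟨k, hk⟩ := Function.ne_iff.1 hy
    obtain ⟨j, hj⟩ := Function.ne_iff.1 hk
    have hsum : 0 < ∑ k, ∑ j, y k j ^ 2 :=
      Finset.sum_pos' (fun _ _ => by positivity) ⟨k, Finset.mem_univ k,
        Finset.sum_pos' (fun _ _ => by positivity)
          ⟨j, Finset.mem_univ j, sq_pos_of_ne_zero hj⟩⟩
    have hnorm : 0 < normY y ^ 2 := by
      rw [normY_sq]
      positivity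
    exact mul_lt_of_lt_one_left hnorm (sub_lt_self _ (by positivity))
  · refine Real.sSup_le ?_ (sub_nonneg.2 ?_)
    · rintro _ ⟨y, hy, rfl⟩
      simpa [hy] using hbound y
    · rw [div_le_one hn0]
      exact_mod_cast (by omega : 1 ≤ n)
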